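/- arXiv:1409.4524 — 2 statements merged into one kernel-verified Lean document; each statement's English description precedes it below -/
import Mathlib

section
/- Assume n = 3, M is irreducible, ρ(M) = 0 and every matrix in M is invertible, and let v be a Barabanov norm. Say two v-extremal solutions x₁, x₂ intersect each other at z if there exist t₁, t₂ > 0 and ε > 0 with x₁(t₁) = x₂(t₂) = z and x₁(s₁) ≠ x₂(s₂) for all s₁ ∈ [t₁−ε, t₁) and s₂ ∈ [t₂−ε, t₂). If two v-extremal solutions intersect each other at some z ∈ ℝ³, then v is Fréchet differentiable at z; if moreover Condition G holds, then there is exactly one v-extremal solution starting from z. -/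
open MeasureTheory Filter Topology RealInnerProductSpace Matrix

noncomputable section

abbrev Vec (n : ℕ) := EuclideanSpace ℝ (Fin n)

def mulE {n : ℕ} (A : Matrix (Fin n) (Fin n) ℝ) (y : Vec n) : Vec n :=
  Matrix.toEuclideanLin A y

def IsSolutionWith {n : ℕ} (M : Set (Matrix (Fin n) (Fin n) ℝ))
    (A : ℝ → Matrix (Fin n) (Fin n) ℝ) (x : ℝ → Vec n) : Prop :=
  (∀ i j, Measurable fun t => A t i j) ∧ (∀ t, A t ∈ M) ∧
    ContinuousOn x (Set.Ici 0) ∧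
    ∀ t ≥ (0:ℝ), x t = x 0 + ∫ s in (0:ℝ)..t, mulE (A s) (x s)

def IsSolution {n : ℕ} (M : Set (Matrix (Fin n) (Fin n) ℝ)) (x : ℝ → Vec n) : Prop :=
  ∃ A, IsSolutionWith M A x

def IsAdjointWith {n : ℕ} (A : ℝ → Matrix (Fin n) (Fin n) ℝ) (l : ℝ → Vec n) : Prop :=
  ContinuousOn l (Set.Ici 0) ∧
    ∀ t ≥ (0:ℝ), l t = l 0 - ∫ s in (0:ℝ)..t, mulE ((A s)ᵀ) (l s)

def IsNorm {n : ℕ} (v : Vec n → ℝ) : Prop :=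
  (∀ x, v x = 0 ↔ x = 0) ∧ (∀ (a : ℝ) (x : Vec n), v (a • x) = |a| * v x) ∧
    ∀ x y, v (x + y) ≤ v x + v y

def IsBarabanov {n : ℕ} (M : Set (Matrix (Fin n) (Fin n) ℝ)) (v : Vec n → ℝ) : Prop :=
  IsNorm v ∧ (∀ x, IsSolution M x → ∀ t ≥ (0:ℝ), v (x t) ≤ v (x 0)) ∧
    ∀ y : Vec n, ∃ x, IsSolution M x ∧ x 0 = y ∧ ∀ t ≥ (0:ℝ), v (x t) = v y

def IsExtremal {n : ℕ} (M : Set (Matrix (Fin n) (Fin n) ℝ)) (v : Vec n → ℝ)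
    (x : ℝ → Vec n) : Prop :=
  IsSolution M x ∧ ∀ t ≥ (0:ℝ), v (x t) = v (x 0)

def subdiff {n : ℕ} (v : Vec n → ℝ) (x : Vec n) : Set (Vec n) :=
  {l | ⟪l, x⟫ = v x ∧ ∀ y, ⟪l, y⟫ ≤ v y}

def MIrreducible {n : ℕ} (M : Set (Matrix (Fin n) (Fin n) ℝ)) : Prop :=
  ∀ W : Submodule ℝ (Vec n), (∀ A ∈ M, ∀ x ∈ W, mulE A x ∈ W) → W = ⊥ ∨ W = ⊤

def rhoZero {n : ℕ} (M : Set (Matrix (Fin n) (Fin n) ℝ)) : Prop :=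
  sSup {r : EReal | ∃ x, IsSolution M x ∧ x 0 ≠ 0 ∧
      r = limsup (fun t => ((Real.log ‖x t‖ / t : ℝ) : EReal)) atTop} = 0

def MaxCondWith {n : ℕ} (M : Set (Matrix (Fin n) (Fin n) ℝ))
    (A : ℝ → Matrix (Fin n) (Fin n) ℝ) (x l : ℝ → Vec n) : Prop :=
  ∀ᵐ t ∂(volume.restrict (Set.Ici (0:ℝ))),
    ∀ B ∈ M, ⟪l t, mulE B (x t)⟫ ≤ ⟪l t, mulE (A t) (x t)⟫

def ConditionG {n : ℕ} (M : Set (Matrix (Fin n) (Fin n) ℝ)) : Prop :=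
  ∀ (x₀ l₀ : Vec n), x₀ ≠ 0 → l₀ ≠ 0 →
  ∀ A₁ A₂ (x₁ x₂ l₁ l₂ : ℝ → Vec n),
    IsSolutionWith M A₁ x₁ → IsSolutionWith M A₂ x₂ →
    IsAdjointWith A₁ l₁ → IsAdjointWith A₂ l₂ →
    x₁ 0 = x₀ → x₂ 0 = x₀ → l₁ 0 = l₀ → l₂ 0 = l₀ →
    MaxCondWith M A₁ x₁ l₁ → MaxCondWith M A₂ x₂ l₂ →
    ∀ t ≥ (0:ℝ), x₁ t = x₂ t ∧ l₁ t = l₂ t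

def omegaLimitSet {n : ℕ} (x : ℝ → Vec n) : Set (Vec n) :=
  {p | ∃ tk : ℕ → ℝ, Tendsto tk atTop atTop ∧ Tendsto (fun k => x (tk k)) atTop (𝓝 p)}

section LinearODE

variable {E : Type*} [NormedAddCommGroup E] [NormedSpace ℝ E]

lemma intervalIntegrable_clm_apply {G : ℝ → E →L[ℝ] E} {K : ℝ} (hG : StronglyMeasurable G)
    (hK : ∀ t, ‖G t‖ ≤ K) {w : ℝ → E} {a b : ℝ} (hw : ContinuousOn w (Set.uIcc a b)) :
    IntervalIntegrable (fun s => G s (w s)) volume a b := by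
  refine (hw.norm.intervalIntegrable.const_mul K).mono_fun ?_ ?_
  · have hw' : AEStronglyMeasurable w (volume.restrict (Set.uIoc a b)) :=
      hw.aestronglyMeasurable_of_subset_isCompact isCompact_uIcc
        measurableSet_uIoc Set.uIoc_subset_uIcc
    exact isBoundedBilinearMap_apply.continuous.comp_aestronglyMeasurable
      (hG.aestronglyMeasurable.prodMk hw')
  · refine Eventually.of_forall fun s => ?_
    have : 0 ≤ K := (norm_nonneg _).trans (hK s)
    change ‖G s (w s)‖ ≤ ‖K * ‖w s‖‖
    rw [Real.norm_of_nonneg (by positivity)]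
    exact (G s).le_of_opNorm_le (hK s) _

lemma abs_integral_exp_mul_abs_le {r : ℝ} (hr : 0 < r) (t : ℝ) :
    |∫ s in (0 : ℝ)..t, Real.exp (r * |s|)| ≤ Real.exp (r * |t|) / r := by
  have key : ∀ t : ℝ, 0 ≤ t →
      ∫ s in (0 : ℝ)..t, Real.exp (r * |s|) = (Real.exp (r * t) - 1) / r := by
    intro t ht
    have : ∫ s in (0 : ℝ)..t, Real.exp (r * |s|) = ∫ s in (0 : ℝ)..t, Real.exp (r * s) := by
      refine intervalIntegral.integral_congr fun s hs => ?_
      rw [Set.uIcc_of_le ht] at hs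
      simp only [abs_of_nonneg hs.1]
    rw [this, intervalIntegral.integral_comp_mul_left (fun s => Real.exp s) hr.ne', integral_exp]
    simp
    ring
  have key2 : ∀ t : ℝ, 0 ≤ t →
      |∫ s in (0 : ℝ)..t, Real.exp (r * |s|)| ≤ Real.exp (r * t) / r := by
    intro t ht
    have h1 : 1 ≤ Real.exp (r * t) := Real.one_le_exp (by positivity)
    rw [key t ht, abs_of_nonneg (div_nonneg (by linarith) hr.le)]
    gcongr
    linarith
  rcases le_total 0 t with ht | ht
  · simpa [abs_of_nonneg ht] using key2 t ht
  · have h2 := key2 (-t) (by linarith)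
    have h3 : ∫ s in (0 : ℝ)..(-t), Real.exp (r * |s|) =
        -∫ s in (0 : ℝ)..t, Real.exp (r * |s|) := by
      rw [← intervalIntegral.integral_symm]
      have := intervalIntegral.integral_comp_neg (a := t) (b := 0) fun s => Real.exp (r * |s|)
      simp only [abs_neg, neg_zero] at this
      exact this.symm
    rw [h3, abs_neg] at h2
    rwa [abs_of_nonpos ht]

lemma exp_mul_norm_integral_le {r C : ℝ} (hr : 0 < r) {w : ℝ → E}
    (hw : ∀ s, ‖w s‖ ≤ C * Real.exp (r * |s|)) (t : ℝ) :
    Real.exp (-(r * |t|)) * ‖∫ s in (0 : ℝ)..t, w s‖ ≤ C / r := by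
  have hC : 0 ≤ C := by simpa using (norm_nonneg _).trans (hw 0)
  have hint : IntervalIntegrable (fun s => C * Real.exp (r * |s|)) volume 0 t :=
    Continuous.intervalIntegrable (by fun_prop) _ _
  have h1 : ‖∫ s in (0 : ℝ)..t, w s‖ ≤ C * (Real.exp (r * |t|) / r) := by
    calc ‖∫ s in (0 : ℝ)..t, w s‖ ≤ |∫ s in (0 : ℝ)..t, C * Real.exp (r * |s|)| :=
          intervalIntegral.norm_integral_le_abs_of_norm_le (Eventually.of_forall hw) hint
      _ = C * |∫ s in (0 : ℝ)..t, Real.exp (r * |s|)| := by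
          rw [intervalIntegral.integral_const_mul, abs_mul, abs_of_nonneg hC]
      _ ≤ _ := by gcongr; exact abs_integral_exp_mul_abs_le hr t
  calc _ ≤ Real.exp (-(r * |t|)) * (C * (Real.exp (r * |t|) / r)) := by gcongr
    _ = (Real.exp (-(r * |t|)) * Real.exp (r * |t|)) * (C / r) := by ring
    _ = C / r := by rw [← Real.exp_add]; simp

/-- Global existence for linear equations with bounded measurable coefficients, with initial
time zero. -/
lemma exists_linear_solution_zero [CompleteSpace E] {G : ℝ → E →L[ℝ] E} {K : ℝ}
    (hG : StronglyMeasurable G) (hK : ∀ t, ‖G t‖ ≤ K) (u : E) :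
    ∃ y : ℝ → E, Continuous y ∧ ∀ t, y t = u + ∫ s in (0 : ℝ)..t, G s (y s) := by
  have hK0 : 0 ≤ K := (norm_nonneg _).trans (hK 0)
  set r : ℝ := 2 * K + 1 with hr_def
  have hr : 0 < r := by positivity
  have hcont : ∀ f : BoundedContinuousFunction ℝ E,
      Continuous fun s => Real.exp (r * |s|) • f s := fun f => by fun_prop
  have hint : ∀ (f : BoundedContinuousFunction ℝ E) (a b : ℝ), IntervalIntegrable
      (fun s => G s (Real.exp (r * |s|) • f s)) volume a b := fun f a b =>
    intervalIntegrable_clm_apply hG hK (hcont f).continuousOn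
  have hprim : ∀ f : BoundedContinuousFunction ℝ E, Continuous fun t =>
      ∫ s in (0 : ℝ)..t, G s (Real.exp (r * |s|) • f s) := fun f =>
    intervalIntegral.continuous_primitive (hint f) 0
  have hbd : ∀ (f : BoundedContinuousFunction ℝ E) (s : ℝ),
      ‖G s (Real.exp (r * |s|) • f s)‖ ≤ (K * ‖f‖) * Real.exp (r * |s|) := by
    intro f s
    calc _ ≤ K * ‖Real.exp (r * |s|) • f s‖ := (G s).le_of_opNorm_le (hK s) _
      _ = K * (Real.exp (r * |s|) * ‖f s‖) := by
          rw [norm_smul, Real.norm_of_nonneg (Real.exp_pos _).le]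
      _ ≤ K * (Real.exp (r * |s|) * ‖f‖) := by gcongr; exact f.norm_coe_le_norm s
      _ = _ := by ring
  let T : BoundedContinuousFunction ℝ E → BoundedContinuousFunction ℝ E := fun f =>
    BoundedContinuousFunction.ofNormedAddCommGroup
      (fun t => Real.exp (-(r * |t|)) • (u + ∫ s in (0 : ℝ)..t, G s (Real.exp (r * |s|) • f s)))
      ((by fun_prop : Continuous fun t : ℝ => Real.exp (-(r * |t|))).smul
        (continuous_const.add (hprim f)))
      (‖u‖ + K * ‖f‖ / r) (by
        intro t
        rw [norm_smul, Real.norm_of_nonneg (Real.exp_pos _).le]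
        have h1 : Real.exp (-(r * |t|)) ≤ 1 :=
          Real.exp_le_one_iff.2 (by have := abs_nonneg t; nlinarith)
        have h2 := exp_mul_norm_integral_le hr (hbd f) t
        have h3 := norm_add_le u (∫ s in (0 : ℝ)..t, G s (Real.exp (r * |s|) • f s))
        have h4 := Real.exp_pos (-(r * |t|))
        have h5 := norm_nonneg u
        nlinarith [mul_le_mul_of_nonneg_left h3 h4.le, mul_le_mul_of_nonneg_right h1 h5])
  have hT : ContractingWith (1 / 2) T := by
    refine ⟨by rw [← NNReal.coe_lt_coe]; norm_num, LipschitzWith.of_dist_le_mul fun f g => ?_⟩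
    refine (BoundedContinuousFunction.dist_le (by positivity)).2 fun t => ?_
    have hsub : T f t - T g t = Real.exp (-(r * |t|)) •
        ∫ s in (0 : ℝ)..t, G s (Real.exp (r * |s|) • (f - g) s) := by
      have : ∫ s in (0 : ℝ)..t, G s (Real.exp (r * |s|) • (f - g) s) =
          (∫ s in (0 : ℝ)..t, G s (Real.exp (r * |s|) • f s)) -
            ∫ s in (0 : ℝ)..t, G s (Real.exp (r * |s|) • g s) := by
        rw [← intervalIntegral.integral_sub (hint f 0 t) (hint g 0 t)]
        simp [smul_sub]
      rw [this]
      change Real.exp (-(r * |t|)) • (u + _) - Real.exp (-(r * |t|)) • (u + _) = _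
      rw [← smul_sub, add_sub_add_left_eq_sub]
    rw [dist_eq_norm, hsub, norm_smul, Real.norm_of_nonneg (Real.exp_pos _).le]
    refine (exp_mul_norm_integral_le hr (hbd (f - g)) t).trans ?_
    rw [dist_eq_norm, div_le_iff₀ hr]
    have := norm_nonneg (f - g)
    push_cast
    nlinarith
  let f := ContractingWith.fixedPoint T hT
  have hf : T f = f := hT.fixedPoint_isFixedPt
  have hfe : ∀ t, Real.exp (r * |t|) • f t =
      u + ∫ s in (0 : ℝ)..t, G s (Real.exp (r * |s|) • f s) := by
    intro t
    have : f t = Real.exp (-(r * |t|)) •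
        (u + ∫ s in (0 : ℝ)..t, G s (Real.exp (r * |s|) • f s)) :=
      (DFunLike.congr_fun hf t).symm
    conv_lhs => rw [this]
    rw [smul_smul, ← Real.exp_add]
    simp
  exact ⟨fun t => Real.exp (r * |t|) • f t, hcont f, hfe⟩

/-- `y` solves `y' = G y` on `[0, ∞)` in the sense of Carathéodory. -/
def IsLinearSolution (G : ℝ → E →L[ℝ] E) (y : ℝ → E) : Prop :=
  ContinuousOn y (Set.Ici 0) ∧ ∀ t ≥ (0 : ℝ), y t = y 0 + ∫ s in (0 : ℝ)..t, G s (y s)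

lemma exists_isLinearSolution [CompleteSpace E] {G : ℝ → E →L[ℝ] E} {K : ℝ}
    (hG : StronglyMeasurable G) (hK : ∀ t, ‖G t‖ ≤ K) (t₀ : ℝ) (u : E) :
    ∃ y : ℝ → E, Continuous y ∧ y t₀ = u ∧ IsLinearSolution G y := by
  obtain ⟨y, hy, hyu⟩ := exists_linear_solution_zero (G := fun s => G (s + t₀))
    (hG.comp_measurable (measurable_id.add_const t₀)) (fun t => hK _) u
  have hy' : ∀ t, y (t - t₀) = u + ∫ s in t₀..t, G s (y (s - t₀)) := by
    intro t
    have := intervalIntegral.integral_comp_add_right (a := 0) (b := t - t₀)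
      (fun s => G s (y (s - t₀))) t₀
    simp only [add_sub_cancel_right, zero_add, sub_add_cancel] at this
    rw [hyu, this]
  have hc : Continuous fun t => y (t - t₀) := hy.comp (continuous_id.sub continuous_const)
  have hi : ∀ a b, IntervalIntegrable (fun s => G s (y (s - t₀))) volume a b := fun a b =>
    intervalIntegrable_clm_apply hG hK hc.continuousOn
  refine ⟨fun t => y (t - t₀), hc, by simp [hyu 0], hc.continuousOn, fun t _ => ?_⟩
  simp only [hy' t, hy' 0]
  rw [add_assoc, intervalIntegral.integral_add_adjacent_intervals (hi _ _) (hi _ _)]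

namespace IsLinearSolution

variable {G : ℝ → E →L[ℝ] E} {K : ℝ} {y : ℝ → E}

lemma intervalIntegrable (hy : IsLinearSolution G y) (hG : StronglyMeasurable G)
    (hK : ∀ t, ‖G t‖ ≤ K) {a b : ℝ} (ha : 0 ≤ a) (hb : 0 ≤ b) :
    IntervalIntegrable (fun s => G s (y s)) volume a b :=
  intervalIntegrable_clm_apply hG hK <| hy.1.mono fun _ hs =>
    (le_inf ha hb).trans hs.1

lemma sub_eq_integral (hy : IsLinearSolution G y) (hG : StronglyMeasurable G)
    (hK : ∀ t, ‖G t‖ ≤ K) {a b : ℝ} (ha : 0 ≤ a) (hb : 0 ≤ b) :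
    y b - y a = ∫ s in a..b, G s (y s) := by
  rw [hy.2 a ha, hy.2 b hb, add_sub_add_left_eq_sub,
    intervalIntegral.integral_interval_sub_left (hy.intervalIntegrable hG hK le_rfl hb)
      (hy.intervalIntegrable hG hK le_rfl ha)]

lemma shift (hy : IsLinearSolution G y) (hG : StronglyMeasurable G)
    (hK : ∀ t, ‖G t‖ ≤ K) {a : ℝ} (ha : 0 ≤ a) :
    IsLinearSolution (fun s => G (s + a)) fun s => y (s + a) := by
  refine ⟨hy.1.comp (by fun_prop) fun s (hs : 0 ≤ s) => add_nonneg hs ha, fun t ht => ?_⟩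
  have h := hy.sub_eq_integral hG hK ha (add_nonneg ht ha)
  rw [intervalIntegral.integral_comp_add_right (fun s => G s (y s))]
  simp only [zero_add]
  rw [← h]
  abel

lemma ae_hasDerivAt (hy : IsLinearSolution G y) (hG : StronglyMeasurable G)
    (hK : ∀ t, ‖G t‖ ≤ K) [CompleteSpace E] :
    ∀ᵐ t, 0 < t → HasDerivAt y (G t (y t)) t := by
  have h : ∀ N : ℕ, ∀ᵐ t, t ∈ Set.uIcc 0 (N : ℝ) → ∀ c ∈ Set.uIcc 0 (N : ℝ),
      HasDerivAt (fun x => ∫ s in c..x, G s (y s)) (G t (y t)) t := fun N =>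
    (hy.intervalIntegrable hG hK le_rfl N.cast_nonneg).ae_hasDerivAt_integral
  filter_upwards [ae_all_iff.2 h] with t ht h0
  obtain ⟨N, hN⟩ := exists_nat_ge t
  have h1 := ht N (by rw [Set.uIcc_of_le N.cast_nonneg]; exact ⟨h0.le, hN⟩) 0 Set.left_mem_uIcc
  refine (h1.const_add (y 0)).congr_of_eventuallyEq ?_
  filter_upwards [lt_mem_nhds h0] with s hs using hy.2 s hs.le

lemma exists_lipschitzOnWith (hy : IsLinearSolution G y) (hG : StronglyMeasurable G)
    (hK : ∀ t, ‖G t‖ ≤ K) (T : ℝ) :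
    ∃ C : ℝ, 0 ≤ C ∧ (∀ t ∈ Set.Icc 0 T, ‖y t‖ ≤ C) ∧
      ∀ s ∈ Set.Icc 0 T, ∀ t ∈ Set.Icc 0 T, ‖y t - y s‖ ≤ K * C * |t - s| := by
  obtain ⟨C, hC⟩ := (isCompact_Icc (a := (0 : ℝ)) (b := T)).exists_bound_of_continuousOn
    (hy.1.mono Set.Icc_subset_Ici_self)
  have hK0 : 0 ≤ K := (norm_nonneg _).trans (hK 0)
  have hC' : ∀ t ∈ Set.Icc 0 T, ‖y t‖ ≤ max C 0 := fun t ht => (hC t ht).trans (le_max_left _ _)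
  refine ⟨max C 0, le_max_right _ _, hC', fun s hs t ht => ?_⟩
  rw [hy.sub_eq_integral hG hK hs.1 ht.1]
  refine intervalIntegral.norm_integral_le_of_norm_le_const fun x hx => ?_
  have hx' : x ∈ Set.Icc 0 T := Set.uIcc_subset_Icc hs ht (Set.uIoc_subset_uIcc hx)
  exact ((G x).le_of_opNorm_le (hK x) _).trans (mul_le_mul_of_nonneg_left (hC' x hx') hK0)

end IsLinearSolution

end LinearODE

/-- The pairing of a solution with a solution of the adjoint equation is constant. -/
lemma IsLinearSolution.inner_adjoint_eq {E : Type*} [NormedAddCommGroup E] [InnerProductSpace ℝ E]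
    [CompleteSpace E] {G : ℝ → E →L[ℝ] E} {K : ℝ} {y l : ℝ → E}
    (hy : IsLinearSolution G y) (hl : IsLinearSolution (fun t => -(G t).adjoint) l)
    (hG : StronglyMeasurable G) (hG' : StronglyMeasurable fun t => -(G t).adjoint)
    (hK : ∀ t, ‖G t‖ ≤ K) {s t : ℝ} (hs : 0 ≤ s) (ht : 0 ≤ t) :
    ⟪l t, y t⟫ = ⟪l s, y s⟫ := by
  have hK' : ∀ t, ‖-(G t).adjoint‖ ≤ K := fun t => by
    rw [norm_neg, LinearIsometryEquiv.norm_map]; exact hK t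
  suffices H : ∀ t, 0 ≤ t → ⟪l t, y t⟫ = ⟪l 0, y 0⟫ by rw [H t ht, H s hs]
  clear hs ht s t
  intro T hT
  have hK0 : 0 ≤ K := (norm_nonneg _).trans (hK 0)
  obtain ⟨C, hC0, hC, hyL⟩ := hy.exists_lipschitzOnWith hG hK T
  obtain ⟨D, hD0, hD, hlL⟩ := hl.exists_lipschitzOnWith hG' hK' T
  have hlip : LipschitzOnWith (Real.toNNReal (2 * K * C * D)) (fun t => ⟪l t, y t⟫)
      (Set.uIcc 0 T) := by
    rw [Set.uIcc_of_le hT]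
    refine LipschitzOnWith.of_dist_le_mul fun t ht s hs => ?_
    rw [Real.coe_toNNReal _ (by positivity), Real.dist_eq, Real.dist_eq]
    have h1 : ⟪l t, y t⟫ - ⟪l s, y s⟫ = ⟪l t - l s, y t⟫ + ⟪l s, y t - y s⟫ := by
      rw [inner_sub_left, inner_sub_right]; ring
    rw [h1]
    calc _ ≤ |⟪l t - l s, y t⟫| + |⟪l s, y t - y s⟫| := abs_add_le _ _
      _ ≤ ‖l t - l s‖ * ‖y t‖ + ‖l s‖ * ‖y t - y s‖ :=
          add_le_add (abs_real_inner_le_norm _ _) (abs_real_inner_le_norm _ _)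
      _ ≤ (K * D * |t - s|) * C + D * (K * C * |t - s|) := by
          have e1 := hlL s hs t ht
          have e2 := hyL s hs t ht
          have e3 := hC t ht
          have e4 := hD s hs
          gcongr
      _ = _ := by ring
  obtain ⟨c, hc⟩ := hlip.absolutelyContinuousOnInterval.const_of_ae_hasDerivAt_zero (by
    have h0 : ∀ᵐ t : ℝ, t ≠ 0 := by simp [ae_iff, measure_singleton]
    filter_upwards [hy.ae_hasDerivAt hG hK, hl.ae_hasDerivAt hG' hK', h0] with t h1 h2 h3 h4
    rw [Set.uIcc_of_le hT] at h4
    have h5 : 0 < t := lt_of_le_of_ne h4.1 h3.symm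
    have h6 := (h2 h5).inner ℝ (h1 h5)
    have h7 : ⟪l t, G t (y t)⟫ + ⟪(-(G t).adjoint) (l t), y t⟫ = 0 := by
      simp [ContinuousLinearMap.adjoint_inner_left]
    rwa [h7] at h6)
  rw [hc T Set.right_mem_uIcc, hc 0 Set.left_mem_uIcc]

namespace IsNorm

variable {n : ℕ} {v : Vec n → ℝ}

lemma map_zero (hv : IsNorm v) : v 0 = 0 := (hv.1 0).2 rfl

lemma map_neg (hv : IsNorm v) (x : Vec n) : v (-x) = v x := by
  simpa using hv.2.1 (-1) x

lemma nonneg (hv : IsNorm v) (x : Vec n) : 0 ≤ v x := by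
  have h := hv.2.2 x (-x)
  rw [add_neg_cancel, hv.map_zero, hv.map_neg] at h
  linarith

lemma map_sum_le (hv : IsNorm v) {ι : Type*} (s : Finset ι) (f : ι → Vec n) :
    v (∑ i ∈ s, f i) ≤ ∑ i ∈ s, v (f i) :=
  Finset.le_sum_of_subadditive v hv.map_zero.le hv.2.2 s f

lemma exists_le_mul_norm (hv : IsNorm v) : ∃ C, 0 ≤ C ∧ ∀ x, v x ≤ C * ‖x‖ := by
  let b := EuclideanSpace.basisFun (Fin n) ℝ
  refine ⟨∑ i, v (b i), Finset.sum_nonneg fun i _ => hv.nonneg _, fun x => ?_⟩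
  calc v x = v (∑ i, x i • b i) := by
        congr 1
        simpa [b] using (b.sum_repr x).symm
    _ ≤ ∑ i, v (x i • b i) := hv.map_sum_le _ _
    _ = ∑ i, |x i| * v (b i) := by simp only [hv.2.1]
    _ ≤ ∑ i, ‖x‖ * v (b i) := by
        gcongr with i
        · exact hv.nonneg _
        · exact PiLp.norm_apply_le x i
    _ = _ := by rw [← Finset.mul_sum, mul_comm]

lemma continuous (hv : IsNorm v) : Continuous v := by
  obtain ⟨C, hC0, hC⟩ := hv.exists_le_mul_norm
  have h : ∀ x y, v x - v y ≤ C * ‖x - y‖ := fun x y => by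
    have := hv.2.2 (x - y) y
    rw [sub_add_cancel] at this
    linarith [hC (x - y)]
  refine (LipschitzWith.of_dist_le_mul (K := C.toNNReal) fun x y => ?_).continuous
  rw [Real.coe_toNNReal _ hC0, dist_eq_norm, dist_eq_norm, Real.norm_eq_abs, abs_le]
  have h2 := h y x
  rw [norm_sub_rev] at h2
  exact ⟨by linarith, h x y⟩

lemma subdiff_nonempty_of_ne_zero (hv : IsNorm v) {x : Vec n} (hx : x ≠ 0) :
    (subdiff v x).Nonempty := by
  obtain ⟨g, hg, hgle⟩ := exists_extension_of_le_sublinear (LinearPMap.mkSpanSingleton x (v x) hx) v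
    (fun c hc y => by rw [hv.2.1, abs_of_pos hc]) hv.2.2 (by
      rintro ⟨y, hy⟩
      obtain ⟨c, rfl⟩ := Submodule.mem_span_singleton.1 hy
      rw [LinearPMap.mkSpanSingleton'_apply]
      simp only [hv.2.1, RingHom.id_apply, smul_eq_mul]
      exact mul_le_mul_of_nonneg_right (le_abs_self c) (hv.nonneg x))
  let l := (InnerProductSpace.toDual ℝ (Vec n)).symm (LinearMap.toContinuousLinearMap g)
  have hl : ∀ y, ⟪l, y⟫ = g y := fun y => by simp [l]
  refine ⟨l, ?_, fun y => (hl y).trans_le (hgle y)⟩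
  rw [hl]
  have := hg ⟨x, Submodule.mem_span_singleton_self x⟩
  rw [this]
  exact LinearPMap.mkSpanSingleton_apply ℝ ℝ hx (v x)

lemma subdiff_nonempty (hv : IsNorm v) (x : Vec n) : (subdiff v x).Nonempty := by
  by_cases hx : x = 0
  · by_cases h : ∃ y : Vec n, y ≠ 0
    · obtain ⟨y, hy⟩ := h
      obtain ⟨l, hl⟩ := hv.subdiff_nonempty_of_ne_zero hy
      exact ⟨l, by rw [hx, inner_zero_right, hv.map_zero], hl.2⟩
    · push Not at h
      exact ⟨0, by simp [hx, hv.map_zero], fun y => by simp [h y, hv.map_zero]⟩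
  · exact hv.subdiff_nonempty_of_ne_zero hx

/-- A norm with a single subgradient at a point is differentiable there. -/
lemma differentiableAt_of_subdiff_subsingleton (hv : IsNorm v) {z : Vec n}
    (hz : (subdiff v z).Subsingleton) : DifferentiableAt ℝ v z := by
  choose m hm using hv.subdiff_nonempty
  obtain ⟨C, hC0, hC⟩ := hv.exists_le_mul_norm
  let s : Set (Vec n) := {l | ∀ y, ⟪l, y⟫ ≤ v y}
  have hs_bd : ∀ l ∈ s, ‖l‖ ≤ C := fun l hl => by
    by_contra! h
    have h1 := (hl l).trans (hC l)
    rw [real_inner_self_eq_norm_sq] at h1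
    nlinarith
  have hs : IsCompact s := by
    refine (isCompact_closedBall (0 : Vec n) C).of_isClosed_subset ?_ fun l hl => by
      simpa using hs_bd l hl
    have : s = ⋂ y, {l | ⟪l, y⟫ ≤ v y} := by ext; simp [s]
    rw [this]
    exact isClosed_iInter fun y => isClosed_le (by fun_prop) continuous_const
  have hms : ∀ x, m x ∈ s := fun x => (hm x).2
  have hinner : Tendsto (fun x => ⟪m x, z⟫) (𝓝 z) (𝓝 (v z)) := by
    have h1 : Tendsto (fun x => C * ‖x - z‖) (𝓝 z) (𝓝 0) := by
      have : Continuous fun x : Vec n => C * ‖x - z‖ := by fun_prop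
      simpa using this.tendsto z
    have h2 : Tendsto (fun x => ⟪m x, x - z⟫) (𝓝 z) (𝓝 0) := by
      refine squeeze_zero_norm (fun x => ?_) h1
      exact (norm_inner_le_norm _ _).trans
        (mul_le_mul_of_nonneg_right (hs_bd _ (hms x)) (norm_nonneg _))
    have h3 := (hv.continuous.tendsto z).sub h2
    rw [sub_zero] at h3
    refine h3.congr fun x => ?_
    rw [inner_sub_right, (hm x).1]
    ring
  have hlim : Tendsto m (𝓝 z) (𝓝 (m z)) := by
    refine hs.tendsto_nhds_of_unique_mapClusterPt (Eventually.of_forall hms) fun l hl hcl => ?_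
    refine hz ⟨?_, hl⟩ (hm z)
    have h1 : MapClusterPt ⟪l, z⟫ (𝓝 z) fun x => ⟪m x, z⟫ :=
      hcl.continuousAt_comp (f := fun w : Vec n => ⟪w, z⟫) (by fun_prop)
    have h2 : NeBot (𝓝 ⟪l, z⟫ ⊓ 𝓝 (v z)) := ClusterPt.mono h1 hinner
    exact eq_of_nhds_neBot h2
  refine HasFDerivAt.differentiableAt (f' := innerSL ℝ (m z)) ?_
  rw [hasFDerivAt_iff_isLittleO]
  refine Asymptotics.IsLittleO.of_bound fun c hc => ?_
  have h1 : ∀ᶠ x in 𝓝 z, ‖m x - m z‖ < c := by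
    have := hlim.sub_const (m z)
    rw [sub_self] at this
    have := this.norm
    rw [norm_zero] at this
    exact this.eventually_lt_const hc
  filter_upwards [h1] with x hx
  have hlow : 0 ≤ v x - v z - ⟪m z, x - z⟫ := by
    rw [inner_sub_right, (hm z).1]
    linarith [(hm z).2 x]
  have hup : v x - v z - ⟪m z, x - z⟫ ≤ ⟪m x - m z, x - z⟫ := by
    rw [inner_sub_left, inner_sub_right (m x), (hm x).1]
    linarith [(hm x).2 z]
  rw [innerSL_apply_apply, Real.norm_of_nonneg hlow]
  exact hup.trans ((real_inner_le_norm _ _).trans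
    (mul_le_mul_of_nonneg_right hx.le (norm_nonneg _)))

lemma subdiff_subsingleton_of_differentiableAt {z : Vec n}
    (hz : DifferentiableAt ℝ v z) : (subdiff v z).Subsingleton := by
  have h : ∀ l ∈ subdiff v z, innerSL ℝ l = fderiv ℝ v z := by
    intro l hl
    have hmin : IsLocalMin (fun x => v x - innerSL ℝ l x) z := by
      refine Eventually.of_forall fun x => ?_
      simp only [innerSL_apply_apply]
      rw [hl.1]
      linarith [hl.2 x]
    have h0 := hmin.hasFDerivAt_eq_zero (hz.hasFDerivAt.sub (innerSL ℝ l).hasFDerivAt)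
    exact (sub_eq_zero.1 h0).symm
  intro l hl l' hl'
  have h1 := (h l hl).trans (h l' hl').symm
  refine ext_inner_right ℝ fun y => ?_
  simpa using DFunLike.congr_fun h1 y

end IsNorm

section Switched

variable {n : ℕ} {M : Set (Matrix (Fin n) (Fin n) ℝ)} {v : Vec n → ℝ}
  {A : ℝ → Matrix (Fin n) (Fin n) ℝ}

/-- `mulE` as a linear map into continuous linear maps. -/
def mulCLM (n : ℕ) : Matrix (Fin n) (Fin n) ℝ →ₗ[ℝ] Vec n →L[ℝ] Vec n :=
  LinearMap.toContinuousLinearMap.toLinearMap ∘ₗ Matrix.toEuclideanLin.toLinearMap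

lemma mulCLM_apply (B : Matrix (Fin n) (Fin n) ℝ) (y : Vec n) : mulCLM n B y = mulE B y := rfl

lemma continuous_mulCLM : Continuous (mulCLM n) := LinearMap.continuous_of_finiteDimensional _

lemma adjoint_mulCLM_apply (B : Matrix (Fin n) (Fin n) ℝ) (y : Vec n) :
    (mulCLM n B).adjoint y = mulE Bᵀ y := by
  refine ext_inner_right ℝ fun w => ?_
  rw [ContinuousLinearMap.adjoint_inner_left, mulCLM_apply, mulE, mulE,
    ← Matrix.conjTranspose_eq_transpose_of_trivial, Matrix.toEuclideanLin_conjTranspose_eq_adjoint,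
    LinearMap.adjoint_inner_left]

lemma exists_norm_mulCLM_le (hM : IsCompact M) : ∃ K : ℝ, ∀ B ∈ M, ‖mulCLM n B‖ ≤ K :=
  hM.exists_bound_of_continuousOn continuous_mulCLM.continuousOn

lemma stronglyMeasurable_mulCLM (hA : ∀ i j, Measurable fun t => A t i j) :
    StronglyMeasurable fun t => mulCLM n (A t) := by
  have h : StronglyMeasurable (fun t i j => A t i j) :=
    (measurable_pi_iff.2 fun i => measurable_pi_iff.2 fun j => hA i j).stronglyMeasurable
  exact continuous_mulCLM.comp_stronglyMeasurable h

lemma stronglyMeasurable_neg_adjoint_mulCLM (hA : ∀ i j, Measurable fun t => A t i j) :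
    StronglyMeasurable fun t => -(mulCLM n (A t)).adjoint :=
  (ContinuousLinearMap.adjoint.continuous.comp_stronglyMeasurable
    (stronglyMeasurable_mulCLM hA)).neg

lemma norm_neg_adjoint_mulCLM_le {K : ℝ} (hK : ∀ t, ‖mulCLM n (A t)‖ ≤ K) (t : ℝ) :
    ‖-(mulCLM n (A t)).adjoint‖ ≤ K := by
  rw [norm_neg, LinearIsometryEquiv.norm_map]
  exact hK t

lemma isSolutionWith_iff {x : ℝ → Vec n} :
    IsSolutionWith M A x ↔ (∀ i j, Measurable fun t => A t i j) ∧ (∀ t, A t ∈ M) ∧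
      IsLinearSolution (fun t => mulCLM n (A t)) x := Iff.rfl

lemma isAdjointWith_iff {l : ℝ → Vec n} :
    IsAdjointWith A l ↔ IsLinearSolution (fun t => -(mulCLM n (A t)).adjoint) l := by
  simp only [IsAdjointWith, IsLinearSolution, _root_.neg_apply, adjoint_mulCLM_apply,
    intervalIntegral.integral_neg, sub_eq_add_neg]

lemma IsSolutionWith.shift {x : ℝ → Vec n} (hM : IsCompact M) (hx : IsSolutionWith M A x) {a : ℝ}
    (ha : 0 ≤ a) : IsSolutionWith M (fun s => A (s + a)) fun s => x (s + a) := by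
  obtain ⟨K, hK⟩ := exists_norm_mulCLM_le hM
  obtain ⟨hA, hAM, hx⟩ := isSolutionWith_iff.1 hx
  exact isSolutionWith_iff.2 ⟨fun i j => (hA i j).comp (measurable_id.add_const a),
    fun t => hAM _, hx.shift (stronglyMeasurable_mulCLM hA) (fun t => hK _ (hAM t)) ha⟩

lemma IsSolutionWith.exists_adjoint {x : ℝ → Vec n} (hM : IsCompact M)
    (hx : IsSolutionWith M A x) (T : ℝ) (p : Vec n) :
    ∃ l : ℝ → Vec n, Continuous l ∧ l T = p ∧ IsAdjointWith A l := by
  obtain ⟨K, hK⟩ := exists_norm_mulCLM_le hM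
  simp only [isAdjointWith_iff]
  exact exists_isLinearSolution (stronglyMeasurable_neg_adjoint_mulCLM hx.1)
    (norm_neg_adjoint_mulCLM_le fun t => hK _ (hx.2.1 t)) T p

lemma IsSolutionWith.exists_solution {x : ℝ → Vec n} (hM : IsCompact M)
    (hx : IsSolutionWith M A x) (T : ℝ) (p : Vec n) :
    ∃ y : ℝ → Vec n, y T = p ∧ IsSolutionWith M A y := by
  obtain ⟨K, hK⟩ := exists_norm_mulCLM_le hM
  obtain ⟨y, -, hyT, hy⟩ := exists_isLinearSolution (stronglyMeasurable_mulCLM hx.1)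
    (fun t => hK _ (hx.2.1 t)) T p
  exact ⟨y, hyT, isSolutionWith_iff.2 ⟨hx.1, hx.2.1, hy⟩⟩

lemma IsSolutionWith.inner_adjoint_eq {x l : ℝ → Vec n} (hM : IsCompact M)
    (hx : IsSolutionWith M A x) (hl : IsAdjointWith A l) {s t : ℝ} (hs : 0 ≤ s) (ht : 0 ≤ t) :
    ⟪l t, x t⟫ = ⟪l s, x s⟫ := by
  obtain ⟨K, hK⟩ := exists_norm_mulCLM_le hM
  exact (isSolutionWith_iff.1 hx).2.2.inner_adjoint_eq (isAdjointWith_iff.1 hl)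
    (stronglyMeasurable_mulCLM hx.1) (stronglyMeasurable_neg_adjoint_mulCLM hx.1)
    (fun t => hK _ (hx.2.1 t)) hs ht

lemma IsSolutionWith.ae_hasDerivAt {x : ℝ → Vec n} (hM : IsCompact M)
    (hx : IsSolutionWith M A x) : ∀ᵐ t, 0 < t → HasDerivAt x (mulE (A t) (x t)) t := by
  obtain ⟨K, hK⟩ := exists_norm_mulCLM_le hM
  exact (isSolutionWith_iff.1 hx).2.2.ae_hasDerivAt (stronglyMeasurable_mulCLM hx.1)
    (fun t => hK _ (hx.2.1 t))

/-- An adjoint solution is determined by its value at any nonnegative time. -/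
lemma IsAdjointWith.eq_of_eq {x l m : ℝ → Vec n} (hM : IsCompact M) (hx : IsSolutionWith M A x)
    (hl : IsAdjointWith A l) (hm : IsAdjointWith A m) {s t : ℝ} (hs : 0 ≤ s) (ht : 0 ≤ t)
    (h : l s = m s) : l t = m t := by
  refine ext_inner_right ℝ fun w => ?_
  obtain ⟨y, rfl, hy⟩ := hx.exists_solution hM t w
  rw [hy.inner_adjoint_eq hM hl hs ht, hy.inner_adjoint_eq hM hm hs ht, h]

lemma IsBarabanov.antitoneOn (hv : IsBarabanov M v) (hM : IsCompact M) {x : ℝ → Vec n}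
    (hx : IsSolutionWith M A x) : AntitoneOn (fun t => v (x t)) (Set.Ici 0) := by
  intro s hs t _ hst
  have h := hv.2.1 _ ⟨_, hx.shift hM hs⟩ (t - s) (sub_nonneg.2 hst)
  simpa using h

/-- Subgradients are transported backwards along extremal solutions by the adjoint equation. -/
lemma IsBarabanov.adjoint_mem_subdiff (hv : IsBarabanov M v) (hM : IsCompact M) {x l : ℝ → Vec n}
    (hx : IsSolutionWith M A x) (hxv : ∀ t ≥ (0 : ℝ), v (x t) = v (x 0)) (hl : IsAdjointWith A l)
    {t T : ℝ} (ht : 0 ≤ t) (htT : t ≤ T) (hT : l T ∈ subdiff v (x T)) :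
    l t ∈ subdiff v (x t) := by
  have hT0 : 0 ≤ T := ht.trans htT
  refine ⟨?_, fun w => ?_⟩
  · rw [hx.inner_adjoint_eq hM hl hT0 ht, hT.1, hxv T hT0, hxv t ht]
  · obtain ⟨y, rfl, hy⟩ := hx.exists_solution hM t w
    rw [hy.inner_adjoint_eq hM hl hT0 ht]
    exact (hT.2 _).trans (hv.antitoneOn hM hy ht hT0 htT)

lemma inner_eq_zero_of_mem_subdiff_of_hasDerivAt {x : ℝ → Vec n}
    (hxv : ∀ t ≥ (0 : ℝ), v (x t) = v (x 0)) {t : ℝ} (ht : 0 < t) {x' l : Vec n}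
    (hx : HasDerivAt x x' t) (hl : l ∈ subdiff v (x t)) : ⟪l, x'⟫ = 0 := by
  have hmax : IsLocalMax (fun s => ⟪l, x s⟫) t := by
    filter_upwards [lt_mem_nhds ht] with s hs
    rw [hl.1, hxv t ht.le, ← hxv s hs.le]
    exact hl.2 _
  have h := (hasDerivAt_const t l).inner ℝ hx
  rw [inner_zero_left, add_zero] at h
  exact hmax.hasDerivAt_eq_zero h

lemma IsBarabanov.inner_mulE_nonpos (hv : IsBarabanov M v) {B : Matrix (Fin n) (Fin n) ℝ}
    (hB : B ∈ M) {p l : Vec n} (hl : l ∈ subdiff v p) : ⟪l, mulE B p⟫ ≤ 0 := by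
  obtain ⟨y, hyc, hyp, hy⟩ := exists_isLinearSolution (G := fun _ : ℝ => mulCLM n B)
    stronglyMeasurable_const (fun _ => le_rfl) 0 p
  have hsol : IsSolutionWith M (fun _ => B) y :=
    isSolutionWith_iff.2 ⟨fun i j => measurable_const, fun _ => hB, hy⟩
  have hcont : Continuous fun s => mulCLM n B (y s) := by fun_prop
  have hint : HasDerivAt (fun t => y 0 + ∫ s in (0 : ℝ)..t, mulCLM n B (y s))
      (mulCLM n B (y 0)) 0 :=
    ((hcont.integral_hasStrictDerivAt 0 0).hasDerivAt).const_add _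
  have hder : HasDerivWithinAt y (mulCLM n B (y 0)) (Set.Ici 0) 0 :=
    hint.hasDerivWithinAt.congr_of_mem (fun t ht => hy.2 t ht) Set.self_mem_Ici
  have hin : HasDerivWithinAt (fun t => ⟪l, y t⟫) ⟪l, mulE B p⟫ (Set.Ici 0) 0 := by
    have := (hasDerivWithinAt_const (0 : ℝ) (Set.Ici (0 : ℝ)) l).inner ℝ hder
    rw [inner_zero_left, add_zero, hyp, mulCLM_apply] at this
    exact this
  refine le_of_tendsto ((hasDerivWithinAt_iff_tendsto_slope' Set.self_notMem_Ioi).1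
    (hin.mono Set.Ioi_subset_Ici_self)) ?_
  filter_upwards [self_mem_nhdsWithin] with t ht
  have ht0 : 0 ≤ t := le_of_lt ht
  rw [slope_def_field, hyp]
  refine div_nonpos_of_nonpos_of_nonneg ?_ (by simpa using ht0)
  have h1 := hv.2.1 y ⟨_, hsol⟩ t ht0
  rw [hyp] at h1
  rw [hl.1]
  linarith [hl.2 (y t)]

/-- From a point of differentiability of a Barabanov norm, Condition G leaves a single extremal
solution. -/
lemma IsBarabanov.extremal_unique (hv : IsBarabanov M v) (hM : IsCompact M) (hG : ConditionG M)
    {z : Vec n} (hz : z ≠ 0) (hdiff : DifferentiableAt ℝ v z) {y₁ y₂ : ℝ → Vec n}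
    (h₁ : IsExtremal M v y₁) (h₂ : IsExtremal M v y₂) (h₁z : y₁ 0 = z) (h₂z : y₂ 0 = z)
    {t : ℝ} (ht : 0 ≤ t) : y₁ t = y₂ t := by
  have huniq := IsNorm.subdiff_subsingleton_of_differentiableAt hdiff
  obtain ⟨l₀, hl₀⟩ := hv.1.subdiff_nonempty z
  have hl₀0 : l₀ ≠ 0 := by
    rintro rfl
    have := hl₀.1
    rw [inner_zero_left] at this
    exact hz ((hv.1.1 z).1 this.symm)
  have key : ∀ {A : ℝ → Matrix (Fin n) (Fin n) ℝ} {y : ℝ → Vec n}, IsSolutionWith M A y →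
      (∀ t ≥ (0 : ℝ), v (y t) = v (y 0)) → y 0 = z →
      ∃ l, IsAdjointWith A l ∧ l 0 = l₀ ∧ MaxCondWith M A y l := by
    intro A y hy hyv hyz
    obtain ⟨l, -, hl0, hl⟩ := hy.exists_adjoint hM 0 l₀
    have hsub : ∀ T, 0 ≤ T → l T ∈ subdiff v (y T) := by
      intro T hT
      obtain ⟨p, hp⟩ := hv.1.subdiff_nonempty (y T)
      obtain ⟨m, -, rfl, hm⟩ := hy.exists_adjoint hM T p
      have hm0 := hv.adjoint_mem_subdiff hM hy hyv hm le_rfl hT hp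
      rw [hyz] at hm0
      rwa [hl.eq_of_eq hM hy hm le_rfl hT (hl0.trans (huniq hl₀ hm0))]
    refine ⟨l, hl, hl0, ?_⟩
    rw [MaxCondWith, ae_restrict_iff' measurableSet_Ici]
    have h0 : ∀ᵐ t : ℝ, t ≠ 0 := by simp [ae_iff, measure_singleton]
    filter_upwards [hy.ae_hasDerivAt hM, h0] with t htd ht0 ht B hB
    have htpos : 0 < t := lt_of_le_of_ne ht ht0.symm
    rw [inner_eq_zero_of_mem_subdiff_of_hasDerivAt hyv htpos (htd htpos) (hsub t ht)]
    exact hv.inner_mulE_nonpos hB (hsub t ht)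
  obtain ⟨⟨A₁, hA₁⟩, hv₁⟩ := h₁
  obtain ⟨⟨A₂, hA₂⟩, hv₂⟩ := h₂
  obtain ⟨l₁, hl₁, hl₁0, hm₁⟩ := key hA₁ hv₁ h₁z
  obtain ⟨l₂, hl₂, hl₂0, hm₂⟩ := key hA₂ hv₂ h₂z
  exact (hG z l₀ hz hl₀0 A₁ A₂ y₁ y₂ l₁ l₂ hA₁ hA₂ hl₁ hl₂ h₁z h₂z hl₁0 hl₂0 hm₁ hm₂ t ht).1

end Switched

section Transversal

variable {n : ℕ} {M : Set (Matrix (Fin n) (Fin n) ℝ)} {v : Vec n → ℝ}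

lemma eventually_inner_mulE_pos (hM : IsCompact M) {z l₁ l₂ d : Vec n}
    (hd : ∀ B ∈ M, ⟪l₁, mulE B z⟫ = 0 → ⟪l₂, mulE B z⟫ = 0 → 0 < ⟪d, mulE B z⟫) :
    ∀ᶠ p : Vec n × Vec n × Vec n in 𝓝 (z, l₁, l₂), ∀ B ∈ M,
      ⟪p.2.1, mulE B p.1⟫ = 0 → ⟪p.2.2, mulE B p.1⟫ = 0 → 0 < ⟪d, mulE B p.1⟫ := by
  refine hM.eventually_forall_of_forall_eventually
    (P := fun (p : Vec n × Vec n × Vec n) (B : Matrix (Fin n) (Fin n) ℝ) =>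
      ⟪p.2.1, mulE B p.1⟫ = 0 → ⟪p.2.2, mulE B p.1⟫ = 0 → 0 < ⟪d, mulE B p.1⟫) fun B hB => ?_
  have hmul : Continuous fun q : (Vec n × Vec n × Vec n) × Matrix (Fin n) (Fin n) ℝ =>
      mulCLM n q.2 q.1.1 :=
    (continuous_mulCLM.comp continuous_snd).clm_apply (continuous_fst.comp continuous_fst)
  simp only [mulCLM_apply] at hmul
  have c {f : (Vec n × Vec n × Vec n) × Matrix (Fin n) (Fin n) ℝ → Vec n} (hf : Continuous f) :
      Continuous fun q : (Vec n × Vec n × Vec n) × Matrix (Fin n) (Fin n) ℝ =>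
        ⟪f q, mulE q.2 q.1.1⟫ := hf.inner hmul
  have c₁ := (c (f := fun q => q.1.2.1) (by fun_prop)).continuousAt (x := ((z, l₁, l₂), B))
  have c₂ := (c (f := fun q => q.1.2.2) (by fun_prop)).continuousAt (x := ((z, l₁, l₂), B))
  have c₃ := (c (f := fun _ => d) (by fun_prop)).continuousAt (x := ((z, l₁, l₂), B))
  by_cases e₁ : ⟪l₁, mulE B z⟫ = 0
  · by_cases e₂ : ⟪l₂, mulE B z⟫ = 0
    · filter_upwards [c₃.eventually_const_lt (hd B hB e₁ e₂)] with q hq _ _ using hq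
    · filter_upwards [c₂.eventually_ne e₂] with q hq _ h using absurd h hq
  · filter_upwards [c₁.eventually_ne e₁] with q hq h using absurd h hq

lemma eventually_not_inner_signs {l₁ l₂ d : Vec n}
    (hd : ∀ w, ⟪l₁, w⟫ = 0 → ⟪l₂, w⟫ = 0 → ⟪d, w⟫ = 0 → w = 0) :
    ∀ᶠ p : (Vec n × Vec n) × Vec n × Vec n in 𝓝 ((l₁, l₂), l₁, l₂), ∀ w, ⟪d, w⟫ = 0 →
      ⟪p.1.1, w⟫ ≤ 0 → ⟪p.1.2, w⟫ ≤ 0 → 0 ≤ ⟪p.2.1, w⟫ → 0 ≤ ⟪p.2.2, w⟫ → w = 0 := by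
  have hS : IsCompact (Metric.sphere (0 : Vec n) 1) := isCompact_sphere 0 1
  have h : ∀ᶠ p : (Vec n × Vec n) × Vec n × Vec n in 𝓝 ((l₁, l₂), l₁, l₂),
      ∀ w ∈ Metric.sphere (0 : Vec n) 1, ¬(⟪d, w⟫ = 0 ∧
        ⟪p.1.1, w⟫ ≤ 0 ∧ ⟪p.1.2, w⟫ ≤ 0 ∧ 0 ≤ ⟪p.2.1, w⟫ ∧ 0 ≤ ⟪p.2.2, w⟫) := by
    refine hS.eventually_forall_of_forall_eventually
      (P := fun (p : (Vec n × Vec n) × Vec n × Vec n) (w : Vec n) => ¬(⟪d, w⟫ = 0 ∧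
        ⟪p.1.1, w⟫ ≤ 0 ∧ ⟪p.1.2, w⟫ ≤ 0 ∧ 0 ≤ ⟪p.2.1, w⟫ ∧ 0 ≤ ⟪p.2.2, w⟫)) fun w hw => ?_
    have hw0 : w ≠ 0 := by
      rintro rfl
      simp at hw
    have c₀ : Continuous fun q : ((Vec n × Vec n) × Vec n × Vec n) × Vec n => ⟪d, q.2⟫ := by
      fun_prop
    have c₁ : Continuous fun q : ((Vec n × Vec n) × Vec n × Vec n) × Vec n => ⟪q.1.1.1, q.2⟫ := by
      fun_prop
    have c₂ : Continuous fun q : ((Vec n × Vec n) × Vec n × Vec n) × Vec n => ⟪q.1.1.2, q.2⟫ := by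
      fun_prop
    have c₃ : Continuous fun q : ((Vec n × Vec n) × Vec n × Vec n) × Vec n => ⟪q.1.2.1, q.2⟫ := by
      fun_prop
    have c₄ : Continuous fun q : ((Vec n × Vec n) × Vec n × Vec n) × Vec n => ⟪q.1.2.2, q.2⟫ := by
      fun_prop
    by_cases e₀ : ⟪d, w⟫ = 0
    swap
    · filter_upwards [c₀.continuousAt.eventually_ne e₀] with q hq h using hq h.1
    rcases lt_trichotomy ⟪l₁, w⟫ 0 with e₁ | e₁ | e₁
    · filter_upwards [c₃.continuousAt.eventually_lt_const e₁] with q hq h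
      exact hq.not_ge h.2.2.2.1
    · rcases lt_trichotomy ⟪l₂, w⟫ 0 with e₂ | e₂ | e₂
      · filter_upwards [c₄.continuousAt.eventually_lt_const e₂] with q hq h
        exact hq.not_ge h.2.2.2.2
      · exact absurd (hd w e₁ e₂ e₀) hw0
      · filter_upwards [c₂.continuousAt.eventually_const_lt e₂] with q hq h
        exact hq.not_ge h.2.2.1
    · filter_upwards [c₁.continuousAt.eventually_const_lt e₁] with q hq h
      exact hq.not_ge h.2.1
  filter_upwards [h] with p hp w h₀ h₁ h₂ h₃ h₄
  by_contra hw
  have hnorm : 0 < ‖w‖ := norm_pos_iff.2 hw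
  refine hp (‖w‖⁻¹ • w) (by simp [norm_smul, hnorm.ne']) ?_
  have hi : 0 ≤ ‖w‖⁻¹ := by positivity
  simp only [inner_smul_right]
  exact ⟨by rw [h₀, mul_zero], mul_nonpos_of_nonneg_of_nonpos hi h₁,
    mul_nonpos_of_nonneg_of_nonpos hi h₂, mul_nonneg hi h₃, mul_nonneg hi h₄⟩

lemma IsSolutionWith.inner_lt_of_forall_pos {A : ℝ → Matrix (Fin n) (Fin n) ℝ} {x : ℝ → Vec n}
    (hM : IsCompact M) (hx : IsSolutionWith M A x) {d : Vec n} {s T : ℝ} (hs : 0 ≤ s) (hsT : s < T)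
    (hpos : ∀ᵐ t, t ∈ Set.Ioc s T → 0 < ⟪d, mulE (A t) (x t)⟫) : ⟪d, x s⟫ < ⟪d, x T⟫ := by
  obtain ⟨K, hK⟩ := exists_norm_mulCLM_le hM
  have hT : 0 ≤ T := hs.trans hsT.le
  have hlin := (isSolutionWith_iff.1 hx).2.2
  have hG := stronglyMeasurable_mulCLM hx.1
  have hK' : ∀ t, ‖mulCLM n (A t)‖ ≤ K := fun t => hK _ (hx.2.1 t)
  have hint := hlin.intervalIntegrable hG hK' hs hT
  have hsub := hlin.sub_eq_integral hG hK' hs hT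
  have hdint : IntervalIntegrable (fun t => ⟪d, mulE (A t) (x t)⟫) volume s T :=
    ⟨(innerSL ℝ d).integrable_comp hint.1, (innerSL ℝ d).integrable_comp hint.2⟩
  have heq : ⟪d, x T⟫ - ⟪d, x s⟫ = ∫ t in s..T, ⟪d, mulE (A t) (x t)⟫ := by
    rw [← inner_sub_right, hsub]
    exact ((innerSL ℝ d).intervalIntegral_comp_comm hint).symm
  have hgt : 0 < ∫ t in s..T, ⟪d, mulE (A t) (x t)⟫ := by
    rw [intervalIntegral.integral_pos_iff_support_of_nonneg_ae' _ hdint]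
    · refine ⟨hsT, ?_⟩
      have h1 : volume (Set.Ioc s T) ≤ volume
          (Function.support (fun t => ⟪d, mulE (A t) (x t)⟫) ∩ Set.Ioc s T) := by
        refine measure_mono_ae ?_
        filter_upwards [hpos] with t ht hmem using ⟨(ht hmem).ne', hmem⟩
      refine lt_of_lt_of_le ?_ h1
      rw [Real.volume_Ioc]
      simpa using hsT
    · rw [Set.uIoc_of_le hsT.le, EventuallyLE, ae_restrict_iff' measurableSet_Ioc]
      filter_upwards [hpos] with t ht hmem using (ht hmem).le
  linarith

/-- An extremal solution arriving at `z` carries adjoint transports of two subgradients at `z`, and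
it crosses the hyperplane orthogonal to a direction `d` which is transversal to the velocities
compatible with these two subgradients. -/
lemma IsBarabanov.exists_adjoint_pair (hv : IsBarabanov M v) (hM : IsCompact M) {z l₁ l₂ d : Vec n}
    (hd : ∀ B ∈ M, ⟪l₁, mulE B z⟫ = 0 → ⟪l₂, mulE B z⟫ = 0 → 0 < ⟪d, mulE B z⟫)
    (hl₁ : l₁ ∈ subdiff v z) (hl₂ : l₂ ∈ subdiff v z) {x : ℝ → Vec n} (hx : IsExtremal M v x)
    {T : ℝ} (hT : 0 < T) (hxT : x T = z) :
    ∃ L : ℝ → Vec n × Vec n, Continuous L ∧ L T = (l₁, l₂) ∧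
      (∀ t, 0 ≤ t → t ≤ T → (L t).1 ∈ subdiff v (x t) ∧ (L t).2 ∈ subdiff v (x t)) ∧
      ∀ᶠ s in 𝓝[<] T, ⟪d, x s⟫ < ⟪d, z⟫ := by
  obtain ⟨⟨A, hA⟩, hxv⟩ := hx
  obtain ⟨L₁, hc₁, h₁T, h₁⟩ := hA.exists_adjoint hM T l₁
  obtain ⟨L₂, hc₂, h₂T, h₂⟩ := hA.exists_adjoint hM T l₂
  have hs₁ : ∀ t, 0 ≤ t → t ≤ T → L₁ t ∈ subdiff v (x t) := fun t ht htT =>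
    hv.adjoint_mem_subdiff hM hA hxv h₁ ht htT (by rwa [h₁T, hxT])
  have hs₂ : ∀ t, 0 ≤ t → t ≤ T → L₂ t ∈ subdiff v (x t) := fun t ht htT =>
    hv.adjoint_mem_subdiff hM hA hxv h₂ ht htT (by rwa [h₂T, hxT])
  refine ⟨fun t => (L₁ t, L₂ t), hc₁.prodMk hc₂, by simp [h₁T, h₂T],
    fun t ht htT => ⟨hs₁ t ht htT, hs₂ t ht htT⟩, ?_⟩
  have hxc : ContinuousAt x T := hA.2.2.1.continuousAt (Ici_mem_nhds hT)
  have hlim : Tendsto (fun t => (x t, L₁ t, L₂ t)) (𝓝 T) (𝓝 (z, l₁, l₂)) := by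
    have := hxc.prodMk (hc₁.continuousAt.prodMk hc₂.continuousAt)
    rw [ContinuousAt, hxT, h₁T, h₂T] at this
    exact this
  have hev := (hlim.eventually (eventually_inner_mulE_pos hM hd)).and (lt_mem_nhds hT)
  obtain ⟨a, haT, ha⟩ := mem_nhdsLE_iff_exists_Ioc_subset.1 (mem_nhdsWithin_of_mem_nhds hev)
  filter_upwards [Ioo_mem_nhdsLT haT] with s hs
  have hs0 : 0 ≤ s := (ha ⟨hs.1, hs.2.le⟩).2.le
  rw [← hxT]
  refine hA.inner_lt_of_forall_pos hM hs0 hs.2 ?_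
  filter_upwards [hA.ae_hasDerivAt hM] with t ht hmem
  have h0 := ha ⟨hs.1.trans hmem.1, hmem.2⟩
  exact h0.1 (A t) (hA.2.1 t)
    (inner_eq_zero_of_mem_subdiff_of_hasDerivAt hxv h0.2 (ht h0.2) (hs₁ t h0.2.le hmem.2))
    (inner_eq_zero_of_mem_subdiff_of_hasDerivAt hxv h0.2 (ht h0.2) (hs₂ t h0.2.le hmem.2))

/-- Two trajectories reaching `z` from the same side of a hyperplane meet a common parallel
hyperplane arbitrarily close to `z`. -/
lemma exists_inner_eq_of_eventually_lt {x₁ x₂ : ℝ → Vec n} {d z : Vec n} {t₁ t₂ : ℝ}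
    (hc₁ : ContinuousAt x₁ t₁) (hc₂ : ContinuousAt x₂ t₂) (h₁ : x₁ t₁ = z) (h₂ : x₂ t₂ = z)
    (hlt₁ : ∀ᶠ s in 𝓝[<] t₁, ⟪d, x₁ s⟫ < ⟪d, z⟫) (hlt₂ : ∀ᶠ s in 𝓝[<] t₂, ⟪d, x₂ s⟫ < ⟪d, z⟫)
    (hcn₁ : ∀ᶠ s in 𝓝[<] t₁, ContinuousAt x₁ s) (hcn₂ : ∀ᶠ s in 𝓝[<] t₂, ContinuousAt x₂ s)
    {a₁ a₂ : ℝ} (ha₁ : a₁ < t₁) (ha₂ : a₂ < t₂) :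
    ∃ s₁ ∈ Set.Ioo a₁ t₁, ∃ s₂ ∈ Set.Ioo a₂ t₂, ⟪d, x₁ s₁⟫ = ⟪d, x₂ s₂⟫ := by
  have key : ∀ {x : ℝ → Vec n} {t a : ℝ}, ContinuousAt x t → x t = z →
      (∀ᶠ s in 𝓝[<] t, ⟪d, x s⟫ < ⟪d, z⟫) → (∀ᶠ s in 𝓝[<] t, ContinuousAt x s) → a < t →
      ∃ b < ⟪d, z⟫, ∀ c ∈ Set.Ico b ⟪d, z⟫, ∃ s ∈ Set.Ioo a t, ⟪d, x s⟫ = c := by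
    intro x t a hc hxt hlt hcn hat
    obtain ⟨r, hrt, hr⟩ := mem_nhdsLT_iff_exists_Ioo_subset.1
      ((hlt.and hcn).and (Ioo_mem_nhdsLT hat))
    obtain ⟨q, hq⟩ := exists_between (show r < t from hrt)
    have hsub : ∀ s ∈ Set.Ico q t, (⟪d, x s⟫ < ⟪d, z⟫ ∧ ContinuousAt x s) ∧ s ∈ Set.Ioo a t :=
      fun s hs => hr ⟨hq.1.trans_le hs.1, hs.2⟩
    have hcont : ContinuousOn (fun s => ⟪d, x s⟫) (Set.Icc q t) := by
      intro s hs
      have : ContinuousAt x s := by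
        rcases hs.2.lt_or_eq with h | rfl
        · exact (hsub s ⟨hs.1, h⟩).1.2
        · exact hc
      exact (continuousAt_const.inner this).continuousWithinAt
    refine ⟨⟪d, x q⟫, (hsub q ⟨le_rfl, hq.2⟩).1.1, fun c hcm => ?_⟩
    obtain ⟨s, hs, hsc⟩ := intermediate_value_Icc hq.2.le hcont
      (show c ∈ Set.Icc ⟪d, x q⟫ ⟪d, x t⟫ from ⟨hcm.1, by rw [hxt]; exact hcm.2.le⟩)
    have hst : s < t := by
      refine lt_of_le_of_ne hs.2 ?_
      rintro rfl
      simp only [hxt] at hsc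
      exact hcm.2.ne hsc.symm
    exact ⟨s, (hsub s ⟨hs.1, hst⟩).2, hsc⟩
  obtain ⟨b₁, hb₁, hs₁⟩ := key hc₁ h₁ hlt₁ hcn₁ ha₁
  obtain ⟨b₂, hb₂, hs₂⟩ := key hc₂ h₂ hlt₂ hcn₂ ha₂
  obtain ⟨s₁, hm₁, e₁⟩ := hs₁ (max b₁ b₂) ⟨le_max_left _ _, max_lt hb₁ hb₂⟩
  obtain ⟨s₂, hm₂, e₂⟩ := hs₂ (max b₁ b₂) ⟨le_max_right _ _, max_lt hb₁ hb₂⟩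
  exact ⟨s₁, hm₁, s₂, hm₂, e₁.trans e₂.symm⟩

/-- In dimension three, two distinct subgradients at `z` confine the compatible velocities to an
open half-line, whose direction `d` completes them to a basis. -/
lemma exists_transversal_direction {M : Set (Matrix (Fin 3) (Fin 3) ℝ)} {v : Vec 3 → ℝ}
    (hconv : Convex ℝ M) (hinv : ∀ B ∈ M, IsUnit B) {z l₁ l₂ : Vec 3} (hz : z ≠ 0)
    (hvz : v z ≠ 0) (hl₁ : l₁ ∈ subdiff v z) (hl₂ : l₂ ∈ subdiff v z) (hne : l₁ ≠ l₂) :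
    ∃ d : Vec 3,
      (∀ B ∈ M, ⟪l₁, mulE B z⟫ = 0 → ⟪l₂, mulE B z⟫ = 0 → 0 < ⟪d, mulE B z⟫) ∧
      ∀ w, ⟪l₁, w⟫ = 0 → ⟪l₂, w⟫ = 0 → ⟪d, w⟫ = 0 → w = 0 := by
  have hind : LinearIndependent ℝ ![l₁, l₂] := by
    rw [LinearIndependent.pair_iff]
    intro a b hab
    have h1 : (a + b) * v z = 0 := by
      have := congrArg (fun w => ⟪w, z⟫) hab
      simp only [inner_add_left, inner_smul_left, inner_zero_left, hl₁.1, hl₂.1] at this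
      simpa [add_mul] using this
    have h2 : b = -a := by
      have := (mul_eq_zero.1 h1).resolve_right hvz
      linarith
    rw [h2, neg_smul, ← sub_eq_add_neg, ← smul_sub] at hab
    have h3 := (smul_eq_zero.1 hab).resolve_right (sub_ne_zero.2 hne)
    exact ⟨h3, by rw [h2, h3, neg_zero]⟩
  let W : Submodule ℝ (Vec 3) := (Submodule.span ℝ (Set.range ![l₁, l₂]))ᗮ
  have hW : Module.finrank ℝ W = 1 := by
    have h1 := Submodule.finrank_add_finrank_orthogonal (Submodule.span ℝ (Set.range ![l₁, l₂]))
    rw [finrank_span_eq_card hind, finrank_euclideanSpace_fin, Fintype.card_fin] at h1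
    change 2 + Module.finrank ℝ W = 3 at h1
    omega
  have hmem : ∀ w, ⟪l₁, w⟫ = 0 → ⟪l₂, w⟫ = 0 → w ∈ W := by
    intro w h1 h2
    rw [Submodule.mem_orthogonal]
    intro u hu
    induction hu using Submodule.span_induction with
    | mem u hu =>
      obtain ⟨i, rfl⟩ := hu
      fin_cases i
      · exact h1
      · exact h2
    | zero => exact inner_zero_left _
    | add a b _ _ ha hb => rw [inner_add_left, ha, hb, add_zero]
    | smul c a _ ha => rw [inner_smul_left, ha, mul_zero]
  obtain ⟨⟨e, heW⟩, he0, he⟩ := finrank_eq_one_iff'.1 hW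
  have he' : e ≠ 0 := fun h => he0 (by simpa using h)
  have hbasis : ∀ w, ⟪l₁, w⟫ = 0 → ⟪l₂, w⟫ = 0 → ⟪e, w⟫ = 0 → w = 0 := by
    intro w h1 h2 h3
    obtain ⟨c, hc⟩ := he ⟨w, hmem w h1 h2⟩
    have hc' : c • e = w := congrArg Subtype.val hc
    rw [← hc', inner_smul_right] at h3
    rcases mul_eq_zero.1 h3 with h | h
    · rw [← hc', h, zero_smul]
    · exact absurd (inner_self_eq_zero.1 h) he'
  have hnz : ∀ B ∈ M, ⟪l₁, mulE B z⟫ = 0 → ⟪l₂, mulE B z⟫ = 0 → ⟪e, mulE B z⟫ ≠ 0 := by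
    intro B hB h1 h2 h3
    have h4 := hbasis _ h1 h2 h3
    obtain ⟨C, hC⟩ := (hinv B hB).exists_left_inv
    refine hz ?_
    have h5 : mulE C (mulE B z) = z := by
      simp only [mulE, Matrix.toLpLin_apply, Matrix.mulVec_mulVec, hC, Matrix.one_mulVec]
    rw [← h5, h4]
    exact map_zero _
  by_cases hpos : ∀ B ∈ M, ⟪l₁, mulE B z⟫ = 0 → ⟪l₂, mulE B z⟫ = 0 → 0 < ⟪e, mulE B z⟫
  · exact ⟨e, hpos, hbasis⟩
  · push Not at hpos
    obtain ⟨B, hB, hB1, hB2, hB3⟩ := hpos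
    refine ⟨-e, fun C hC hC1 hC2 => ?_, fun w h1 h2 h3 => hbasis w h1 h2 (by
      simpa [inner_neg_left] using h3)⟩
    have hB4 : ⟪e, mulE B z⟫ < 0 := lt_of_le_of_ne hB3 (hnz B hB hB1 hB2)
    rw [inner_neg_left, neg_pos]
    by_contra! hC3
    set a := ⟪e, mulE C z⟫ with ha
    set b := -⟪e, mulE B z⟫ with hb
    have hb0 : 0 < b := by rw [hb]; linarith
    have hab : 0 < a + b := by linarith
    have hlin : ∀ s t : ℝ, mulE (s • B + t • C) z = s • mulE B z + t • mulE C z := by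
      intro s t
      simp only [← mulCLM_apply, map_add, map_smul, _root_.add_apply, _root_.smul_apply]
    refine hnz ((a / (a + b)) • B + (b / (a + b)) • C)
      (hconv hB hC (by positivity) (by positivity) (by field_simp)) ?_ ?_ ?_
    · rw [hlin, inner_add_right, inner_smul_right, inner_smul_right, hB1, hC1]; simp
    · rw [hlin, inner_add_right, inner_smul_right, inner_smul_right, hB2, hC2]; simp
    · rw [hlin, inner_add_right, inner_smul_right, inner_smul_right, ← ha,
        show ⟪e, mulE B z⟫ = -b by rw [hb]; ring]
      ring

end Transversal

/-- Two extremal solutions in `ℝ³` that are disjoint just before reaching a common point `z`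
meet at a point of differentiability of the Barabanov norm. -/
lemma IsBarabanov.differentiableAt_of_intersect {M : Set (Matrix (Fin 3) (Fin 3) ℝ)}
    {v : Vec 3 → ℝ} (hv : IsBarabanov M v) (hM : IsCompact M) (hconv : Convex ℝ M)
    (hinv : ∀ B ∈ M, IsUnit B) {x₁ x₂ : ℝ → Vec 3} (h₁ : IsExtremal M v x₁)
    (h₂ : IsExtremal M v x₂) {z : Vec 3} (hz : z ≠ 0) {t₁ t₂ ε : ℝ} (ht₁ : 0 < t₁) (ht₂ : 0 < t₂)
    (hε : 0 < ε) (hz₁ : x₁ t₁ = z) (hz₂ : x₂ t₂ = z)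
    (hsep : ∀ s₁ ∈ Set.Ico (t₁ - ε) t₁, ∀ s₂ ∈ Set.Ico (t₂ - ε) t₂, x₁ s₁ ≠ x₂ s₂) :
    DifferentiableAt ℝ v z := by
  by_contra hdiff
  have hnot := mt hv.1.differentiableAt_of_subdiff_subsingleton hdiff
  rw [Set.not_subsingleton_iff] at hnot
  obtain ⟨l₁, hl₁, l₂, hl₂, hne⟩ := hnot
  have hvz : v z ≠ 0 := fun h => hz ((hv.1.1 z).1 h)
  obtain ⟨d, hd, hbasis⟩ := exists_transversal_direction hconv hinv hz hvz hl₁ hl₂ hne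
  obtain ⟨L, hLc, hLt, hLs, hLlt⟩ := hv.exists_adjoint_pair hM hd hl₁ hl₂ h₁ ht₁ hz₁
  obtain ⟨N, hNc, hNt, hNs, hNlt⟩ := hv.exists_adjoint_pair hM hd hl₁ hl₂ h₂ ht₂ hz₂
  have hlim : Tendsto (fun q : ℝ × ℝ => (L q.1, N q.2)) (𝓝 t₁ ×ˢ 𝓝 t₂)
      (𝓝 ((l₁, l₂), l₁, l₂)) := by
    rw [← nhds_prod_eq, ← hLt]
    nth_rewrite 2 [hLt]
    rw [← hNt]
    exact ((hLc.comp continuous_fst).prodMk (hNc.comp continuous_snd)).tendsto (t₁, t₂)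
  obtain ⟨p₁, hp₁, p₂, hp₂, hp⟩ :=
    eventually_prod_iff.1 (hlim.eventually (eventually_not_inner_signs hbasis))
  obtain ⟨a₁, ha₁, hI₁⟩ := mem_nhdsLT_iff_exists_Ioo_subset.1 (mem_nhdsWithin_of_mem_nhds
    ((hp₁.and (lt_mem_nhds ht₁)).and (lt_mem_nhds (sub_lt_self t₁ hε))))
  obtain ⟨a₂, ha₂, hI₂⟩ := mem_nhdsLT_iff_exists_Ioo_subset.1 (mem_nhdsWithin_of_mem_nhds
    ((hp₂.and (lt_mem_nhds ht₂)).and (lt_mem_nhds (sub_lt_self t₂ hε))))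
  have hcont : ∀ {x : ℝ → Vec 3}, IsExtremal M v x → ∀ {t : ℝ}, 0 < t → ContinuousAt x t :=
    fun hx t ht => by
      obtain ⟨⟨A, hA⟩, -⟩ := hx
      exact hA.2.2.1.continuousAt (Ici_mem_nhds ht)
  obtain ⟨s₁, hs₁, s₂, hs₂, heq⟩ := exists_inner_eq_of_eventually_lt (hcont h₁ ht₁) (hcont h₂ ht₂)
    hz₁ hz₂ hLlt hNlt
    (mem_nhdsWithin_of_mem_nhds ((lt_mem_nhds ht₁).mono fun s hs => hcont h₁ hs))
    (mem_nhdsWithin_of_mem_nhds ((lt_mem_nhds ht₂).mono fun s hs => hcont h₂ hs)) ha₁ ha₂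
  obtain ⟨⟨q₁, hs₁0⟩, hs₁ε⟩ := hI₁ hs₁
  obtain ⟨⟨q₂, hs₂0⟩, hs₂ε⟩ := hI₂ hs₂
  have hv₁ : v (x₁ s₁) = v z := by rw [h₁.2 s₁ hs₁0.le, ← hz₁, h₁.2 t₁ ht₁.le]
  have hv₂ : v (x₂ s₂) = v z := by rw [h₂.2 s₂ hs₂0.le, ← hz₂, h₂.2 t₂ ht₂.le]
  have hsub₁ := hLs s₁ hs₁0.le hs₁.2.le
  have hsub₂ := hNs s₂ hs₂0.le hs₂.2.le
  have hle₁ : ∀ l ∈ subdiff v (x₁ s₁), ⟪l, x₂ s₂ - x₁ s₁⟫ ≤ 0 := fun l hl => by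
    rw [inner_sub_right, hl.1, hv₁, ← hv₂]
    linarith [hl.2 (x₂ s₂)]
  have hle₂ : ∀ l ∈ subdiff v (x₂ s₂), 0 ≤ ⟪l, x₂ s₂ - x₁ s₁⟫ := fun l hl => by
    rw [inner_sub_right, hl.1, hv₂, ← hv₁]
    linarith [hl.2 (x₁ s₁)]
  have hzero := hp q₁ q₂ (x₂ s₂ - x₁ s₁) (by rw [inner_sub_right, heq, sub_self])
    (hle₁ _ hsub₁.1) (hle₁ _ hsub₁.2) (hle₂ _ hsub₂.1) (hle₂ _ hsub₂.2)
  exact hsep s₁ ⟨hs₁ε.le, hs₁.2⟩ s₂ ⟨hs₂ε.le, hs₂.2⟩ (sub_eq_zero.1 hzero).symm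

theorem stmt5 (M : Set (Matrix (Fin 3) (Fin 3) ℝ))
    (hne : M.Nonempty) (hcpt : IsCompact M) (hconv : Convex ℝ M)
    (hirr : MIrreducible M) (hrho : rhoZero M) (hinv : ∀ A ∈ M, IsUnit A)
    (v : Vec 3 → ℝ) (hv : IsBarabanov M v)
    (x₁ x₂ : ℝ → Vec 3) (h1 : IsExtremal M v x₁) (h2 : IsExtremal M v x₂)
    (z : Vec 3) (t₁ t₂ ε : ℝ) (ht₁ : 0 < t₁) (ht₂ : 0 < t₂) (hε : 0 < ε)
    (hz1 : x₁ t₁ = z) (hz2 : x₂ t₂ = z)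
    (hsep : ∀ s₁ ∈ Set.Ico (t₁ - ε) t₁, ∀ s₂ ∈ Set.Ico (t₂ - ε) t₂, x₁ s₁ ≠ x₂ s₂) :
    DifferentiableAt ℝ v z ∧
      (ConditionG M →
        (∃ y : ℝ → Vec 3, IsExtremal M v y ∧ y 0 = z) ∧
        ∀ y₁ y₂ : ℝ → Vec 3, IsExtremal M v y₁ → IsExtremal M v y₂ →
          y₁ 0 = z → y₂ 0 = z → ∀ t ≥ (0:ℝ), y₁ t = y₂ t) := by
  have hz : z ≠ 0 := by
    rintro rfl
    have hzero : ∀ {x : ℝ → Vec 3}, IsExtremal M v x → ∀ {t : ℝ}, 0 < t → x t = 0 →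
        ∀ s, 0 ≤ s → x s = 0 := by
      intro x hx t ht hxt s hs
      have h := hx.2 t ht.le
      rw [hxt, hv.1.map_zero, ← hx.2 s hs] at h
      exact (hv.1.1 _).1 h.symm
    have m₁ : max (t₁ - ε) 0 ∈ Set.Ico (t₁ - ε) t₁ :=
      ⟨le_max_left _ _, max_lt (sub_lt_self _ hε) ht₁⟩
    have m₂ : max (t₂ - ε) 0 ∈ Set.Ico (t₂ - ε) t₂ :=
      ⟨le_max_left _ _, max_lt (sub_lt_self _ hε) ht₂⟩
    refine hsep _ m₁ _ m₂ ?_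
    rw [hzero h1 ht₁ hz1 _ (le_max_right _ _), hzero h2 ht₂ hz2 _ (le_max_right _ _)]
  have hdiff := hv.differentiableAt_of_intersect hcpt hconv hinv h1 h2 hz ht₁ ht₂ hε hz1 hz2 hsep
  refine ⟨hdiff, fun hG => ⟨?_, fun y₁ y₂ hy₁ hy₂ e₁ e₂ t ht =>
    hv.extremal_unique hcpt hG hz hdiff hy₁ hy₂ e₁ e₂ ht⟩⟩
  obtain ⟨y, hy, hy0, hyv⟩ := hv.2.2 z
  exact ⟨y, ⟨hy, fun t ht => by rw [hyv t ht, hy0]⟩, hy0⟩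
end
end

section
/- Assume M is irreducible, ρ(M) = 0 and every matrix in M is invertible, and let v be a Barabanov norm with unit sphere S. Then for every affine hyperplane P of ℝⁿ, the set S ∩ P has empty relative interior in P, i.e. S ∩ P contains no nonempty subset that is open in the subspace topology of P. -/
open MeasureTheory Filter Topology RealInnerProductSpace Matrix

noncomputable section

/-- The trajectory of the constant switching signal `A` starting at `y`. -/
def expTraj {n : ℕ} (A : Matrix (Fin n) (Fin n) ℝ) (y : Vec n) (t : ℝ) : Vec n :=
  NormedSpace.exp (t • Matrix.toEuclideanCLM (n := Fin n) (𝕜 := ℝ) A) y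

theorem expTraj_zero {n : ℕ} (A : Matrix (Fin n) (Fin n) ℝ) (y : Vec n) : expTraj A y 0 = y := by
  have h : (0 : ℝ) • Matrix.toEuclideanCLM (n := Fin n) (𝕜 := ℝ) A = 0 := by
    ext; simp
  simp [expTraj, h]

theorem hasDerivAt_expTraj {n : ℕ} (A : Matrix (Fin n) (Fin n) ℝ) (y : Vec n) (t : ℝ) :
    HasDerivAt (expTraj A y) (mulE A (expTraj A y t)) t :=
  ((hasDerivAt_exp_smul_const' (𝕂 := ℝ)
    (Matrix.toEuclideanCLM (n := Fin n) (𝕜 := ℝ) A) t).clm_apply (hasDerivAt_const t y)).congr_deriv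
      (by simp [mulE, expTraj]; rfl)

theorem isSolution_expTraj {n : ℕ} {M : Set (Matrix (Fin n) (Fin n) ℝ)}
    {A : Matrix (Fin n) (Fin n) ℝ} (hA : A ∈ M) (y : Vec n) : IsSolution M (expTraj A y) := by
  have hc := continuous_iff_continuousAt.2 fun t => (hasDerivAt_expTraj A y t).continuousAt
  refine ⟨fun _ => A, fun _ _ => measurable_const, fun _ => hA, hc.continuousOn, fun t _ => ?_⟩
  have hint : Continuous fun s : ℝ => mulE A (expTraj A y s) :=
    (LinearMap.continuous_of_finiteDimensional (Matrix.toEuclideanLin A)).comp hc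
  rw [intervalIntegral.integral_eq_sub_of_hasDerivAt (fun s _ => hasDerivAt_expTraj A y s)
    (hint.intervalIntegrable _ _)]
  abel

theorem mulE_eq_sum {n : ℕ} (A : Matrix (Fin n) (Fin n) ℝ) (y : Vec n) :
    mulE A y = ∑ i, ∑ j, (A i j * y j) • EuclideanSpace.single i (1 : ℝ) := by
  ext k
  simp [mulE, Matrix.toEuclideanLin, Matrix.mulVec, dotProduct, Pi.single_apply,
    Finset.sum_apply]

theorem continuous_mulE {n : ℕ} :
    Continuous fun p : Matrix (Fin n) (Fin n) ℝ × Vec n => mulE p.1 p.2 := by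
  simp only [mulE_eq_sum]
  fun_prop

theorem IsSolutionWith.intervalIntegrable_mulE {n : ℕ} {M : Set (Matrix (Fin n) (Fin n) ℝ)}
    (hM : IsCompact M) {A : ℝ → Matrix (Fin n) (Fin n) ℝ} {x : ℝ → Vec n}
    (h : IsSolutionWith M A x) {t : ℝ} (ht : 0 ≤ t) :
    IntervalIntegrable (fun s => mulE (A s) (x s)) volume 0 t := by
  obtain ⟨hmeas, hmem, hcont, -⟩ := h
  have key : ∀ i j, IntervalIntegrable
      (fun s => (A s i j * x s j) • EuclideanSpace.single i (1 : ℝ)) volume 0 t := by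
    intro i j
    obtain ⟨C, hC⟩ := hM.exists_bound_of_continuousOn
      (f := fun B : Matrix (Fin n) (Fin n) ℝ => B i j) (by fun_prop)
    have hA : IntervalIntegrable (fun s => A s i j) volume 0 t :=
      (intervalIntegrable_const (c := C)).mono_fun (hmeas i j).aestronglyMeasurable
        (ae_of_all _ fun s => (hC _ (hmem s)).trans (le_abs_self C))
    have hx : ContinuousOn (fun s => x s j) (Set.uIcc 0 t) := by
      have : ContinuousOn x (Set.uIcc 0 t) :=
        hcont.mono (by rw [Set.uIcc_of_le ht]; exact Set.Icc_subset_Ici_self)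
      fun_prop
    have := hA.mul_continuousOn hx
    exact ⟨this.1.smul_const _, this.2.smul_const _⟩
  have : (fun s => mulE (A s) (x s)) =
      ∑ i, ∑ j, fun s => (A s i j * x s j) • EuclideanSpace.single i (1 : ℝ) := by
    ext1 s
    simp only [mulE_eq_sum, Finset.sum_apply]
  rw [this]
  exact IntervalIntegrable.sum _ fun i _ => IntervalIntegrable.sum _ fun j _ => key i j

/-- If the unit sphere of a norm contains a relatively open piece of a hyperplane, the norm is
linear near that piece. -/
theorem IsNorm.eventually_eq_inner {n : ℕ} {v : Vec n → ℝ} (hv : IsNorm v) {w z : Vec n} {c ε : ℝ}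
    (hz : v z = 1) (hwz : ⟪w, z⟫ = c) (hε : 0 < ε)
    (h : ∀ y : Vec n, ⟪w, y⟫ = c → dist y z < ε → v y = 1) :
    c ≠ 0 ∧ ∀ᶠ y in 𝓝 z, v y = ⟪c⁻¹ • w, y⟫ := by
  have hc : c ≠ 0 := by
    rintro rfl
    have hcont : Tendsto (fun r : ℝ => r • z) (𝓝[>] 1) (𝓝 z) := by
      have : Continuous fun r : ℝ => r • z := by fun_prop
      simpa using (this.tendsto 1).mono_left nhdsWithin_le_nhds
    obtain ⟨r, hr, hr1⟩ := ((hcont.eventually (Metric.ball_mem_nhds z hε)).and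
      self_mem_nhdsWithin).exists
    have h1 := h (r • z) (by simp [inner_smul_right, hwz]) hr
    have hr1 : 1 < r := hr1
    rw [hv.2.1, hz, abs_of_pos (by linarith)] at h1
    linarith
  refine ⟨hc, ?_⟩
  have hin : Tendsto (fun y : Vec n => ⟪w, y⟫) (𝓝 z) (𝓝 c) := by
    have : Continuous fun y : Vec n => ⟪w, y⟫ := by fun_prop
    simpa [hwz] using this.tendsto z
  have hq : Tendsto (fun y : Vec n => ⟪c⁻¹ • w, y⟫) (𝓝 z) (𝓝 1) := by
    simpa [inner_smul_left, hc] using hin.const_mul c⁻¹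
  have hproj : Tendsto (fun y : Vec n => (⟪c⁻¹ • w, y⟫)⁻¹ • y) (𝓝 z) (𝓝 z) := by
    simpa using (hq.inv₀ one_ne_zero).smul tendsto_id
  filter_upwards [hq.eventually (lt_mem_nhds one_pos),
    hproj.eventually (Metric.ball_mem_nhds z hε)] with y hpos hy
  have hin' : ⟪w, (⟪c⁻¹ • w, y⟫)⁻¹ • y⟫ = c := by
    have hne := hpos.ne'
    rw [inner_smul_left] at hne
    have : ⟪w, y⟫ ≠ 0 := right_ne_zero_of_mul hne
    simp [inner_smul_left, inner_smul_right]
    field_simp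
  have h1 := h _ hin' hy
  rw [hv.2.1, abs_of_pos (inv_pos.2 hpos)] at h1
  exact ((inv_mul_eq_one₀ hpos.ne').1 h1).symm

theorem IsBarabanov.inner_mulE_nonpos_s10 {n : ℕ} {M : Set (Matrix (Fin n) (Fin n) ℝ)}
    {v : Vec n → ℝ} (hv : IsBarabanov M v) {A : Matrix (Fin n) (Fin n) ℝ} (hA : A ∈ M)
    {u y : Vec n} (h : ∀ᶠ y' in 𝓝 y, v y' = ⟪u, y'⟫) : ⟪u, mulE A y⟫ ≤ 0 := by
  set x : ℝ → Vec n := expTraj A y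
  have hx0 : x 0 = y := expTraj_zero A y
  have hd : HasDerivAt x (mulE A y) 0 := by
    simpa only [expTraj_zero] using hasDerivAt_expTraj A y 0
  have hg : HasDerivAt (fun t => ⟪u, x t⟫) ⟪u, mulE A y⟫ 0 :=
    ((innerSL ℝ u).hasFDerivAt.comp_hasDerivAt (0 : ℝ) hd)
  have hev : ∀ᶠ t in 𝓝[>] (0 : ℝ), v (x t) = ⟪u, x t⟫ := by
    have : Tendsto x (𝓝 0) (𝓝 y) := by simpa [hx0] using hd.continuousAt.tendsto
    exact (this.mono_left nhdsWithin_le_nhds).eventually h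
  refine le_of_tendsto hg.tendsto_slope_zero_right ?_
  filter_upwards [hev, self_mem_nhdsWithin] with t ht ht0
  have ht0 : 0 < t := ht0
  have hle := hv.2.1 x (isSolution_expTraj hA y) t ht0.le
  rw [ht, hx0, h.self_of_nhds] at hle
  simp only [zero_add, hx0, smul_eq_mul]
  exact mul_nonpos_of_nonneg_of_nonpos (inv_nonneg.2 ht0.le) (by linarith)

theorem IsBarabanov.exists_inner_mulE_nonneg {n : ℕ} {M : Set (Matrix (Fin n) (Fin n) ℝ)}
    (hM : IsCompact M) {v : Vec n → ℝ} (hv : IsBarabanov M v)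
    {u z : Vec n} (h : ∀ᶠ y in 𝓝 z, v y = ⟪u, y⟫) : ∃ A ∈ M, 0 ≤ ⟪u, mulE A z⟫ := by
  by_contra! hneg
  obtain ⟨x, ⟨A, hsol⟩, hx0, hx⟩ := hv.2.2 z
  have hcont : Continuous fun p : Vec n × Matrix (Fin n) (Fin n) ℝ => ⟪u, mulE p.2 p.1⟫ :=
    continuous_const.inner (continuous_mulE.comp continuous_swap)
  have hlt : ∀ᶠ y in 𝓝 z, ∀ B ∈ M, ⟪u, mulE B y⟫ < 0 :=
    hM.eventually_forall_of_forall_eventually fun B hB =>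
      hcont.continuousAt.eventually_lt_const (hneg B hB)
  have hxt : Tendsto x (𝓝[≥] 0) (𝓝 z) := hx0 ▸ hsol.2.2.1 0 Set.self_mem_Ici
  have hev := hxt.eventually (hlt.and h)
  obtain ⟨t, ht0, ht⟩ := mem_nhdsGE_iff_exists_Icc_subset.1 hev
  have ht0 : (0 : ℝ) < t := ht0
  have hint := hsol.intervalIntegrable_mulE hM ht0.le
  have hint' : IntervalIntegrable (fun s => ⟪u, mulE (A s) (x s)⟫) volume 0 t :=
    ⟨hint.1.const_inner u, hint.2.const_inner u⟩
  have heq : ⟪u, x t⟫ = ⟪u, z⟫ + ∫ s in (0 : ℝ)..t, ⟪u, mulE (A s) (x s)⟫ := by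
    rw [hsol.2.2.2 t ht0.le, hx0, inner_add_right]
    congr 1
    exact ((innerSL ℝ u).intervalIntegral_comp_comm hint).symm
  have hpos : 0 < ∫ s in (0 : ℝ)..t, -⟪u, mulE (A s) (x s)⟫ := by
    refine intervalIntegral.intervalIntegral_pos_of_pos_on hint'.neg (fun s hs => neg_pos.2 ?_) ht0
    exact (ht (Set.Ioo_subset_Icc_self hs)).1 (A s) (hsol.2.1 s)
  rw [intervalIntegral.integral_neg] at hpos
  have h1 : v (x t) = ⟪u, x t⟫ := (ht ⟨ht0.le, le_rfl⟩).2
  have h2 := h.self_of_nhds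
  have h3 := hx t ht0.le
  linarith

theorem stmt10 (n : ℕ) (hn : 0 < n) (M : Set (Matrix (Fin n) (Fin n) ℝ))
    (hne : M.Nonempty) (hcpt : IsCompact M) (hconv : Convex ℝ M)
    (hirr : MIrreducible M) (hrho : rhoZero M) (hinv : ∀ A ∈ M, IsUnit A)
    (v : Vec n → ℝ) (hv : IsBarabanov M v) :
    ∀ (w : Vec n) (cst : ℝ), w ≠ 0 →
      ¬ ∃ z : Vec n, v z = 1 ∧ ⟪w, z⟫ = cst ∧
        ∃ ε > (0:ℝ), ∀ y : Vec n, ⟪w, y⟫ = cst → dist y z < ε → v y = 1 := by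
  rintro w c hw ⟨z, hz, hwz, ε, hε, h⟩
  obtain ⟨hc, hlin⟩ := hv.1.eventually_eq_inner hz hwz hε h
  obtain ⟨A, hA, hAz⟩ := hv.exists_inner_mulE_nonneg hcpt hlin
  set g : Vec n →L[ℝ] ℝ :=
    (innerSL ℝ (c⁻¹ • w)).comp (Matrix.toEuclideanCLM (n := Fin n) (𝕜 := ℝ) A) with hg
  have hmax : IsLocalMax g z := by
    filter_upwards [eventually_eventually_nhds.2 hlin] with y hy
    exact (hv.inner_mulE_nonpos_s10 hA hy).trans hAz
  have hg0 : g = 0 := hmax.hasFDerivAt_eq_zero g.hasFDerivAt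
  have hsurj : mulE A (mulE A⁻¹ w) = w := by
    have hdet := (Matrix.isUnit_iff_isUnit_det A).1 (hinv A hA)
    simp [mulE, Matrix.toLpLin_apply, Matrix.mulVec_mulVec, Matrix.mul_nonsing_inv A hdet]
  have h0 : ⟪c⁻¹ • w, mulE A (mulE A⁻¹ w)⟫ = 0 := DFunLike.congr_fun hg0 (mulE A⁻¹ w)
  rw [hsurj, inner_smul_left] at h0
  simp [hc, hw] at h0
end
end
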